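/- arXiv:1809.00788 — 4 statements merged into one kernel-verified Lean document; each statement's English description precedes it below -/
import Mathlib

section
/- Let Φ₁, Φ₂, Φ₃ be Young functions with generalized inverses Φᵢ⁻¹(s) = inf { r ≥ 0 : Φᵢ(r) > s }. Then the following statements are equivalent: (1) there exists C > 0 such that Φ₁⁻¹(t)·Φ₂⁻¹(t) ≤ C·Φ₃⁻¹(t) for all t ≥ 0; (2) there exists C > 0 such that Φ₃(st/C) ≤ Φ₁(s) + Φ₂(t) for all s, t ≥ 0; (3) there exists M > 0 such that ‖fg‖_{L_{Φ₃}} ≤ M·‖f‖_{L_{Φ₁}}·‖g‖_{L_{Φ₂}} for every f ∈ L_{Φ₁}(ℝⁿ) and g ∈ L_{Φ₂}(ℝⁿ); (4) for every f ∈ L_{Φ₁}(ℝⁿ) and g ∈ L_{Φ₂}(ℝⁿ), the product fg belongs to L_{Φ₃}(ℝⁿ). -/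
open MeasureTheory ENNReal Filter

/-- A Young function: convex on `[0,∞)`, left-continuous, `Φ 0 = 0`,
nonnegative on `[0,∞)`, and `Φ t → ∞` as `t → ∞`. -/
structure IsYoung (Φ : ℝ → ℝ) : Prop where
  nonneg : ∀ t, 0 ≤ t → 0 ≤ Φ t
  convexOn : ConvexOn ℝ (Set.Ici 0) Φ
  leftCont : ∀ t, 0 < t → ContinuousWithinAt Φ (Set.Iic t) t
  map_zero : Φ 0 = 0
  tendsto_top : Tendsto Φ atTop atTop

/-- Generalized inverse `Φ⁻¹(s) = inf {r ≥ 0 : Φ r > s}`. -/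
noncomputable def youngInv (Φ : ℝ → ℝ) (s : ℝ) : ℝ :=
  sInf {r : ℝ | 0 ≤ r ∧ s < Φ r}

/-- The set `{b > 0 : ∫ Φ(|f|/b) dμ ≤ 1}` defining the Luxemburg norm. -/
def orliczSet {α : Type*} [MeasurableSpace α] (μ : Measure α) (Φ : ℝ → ℝ)
    (f : α → ℝ) : Set ℝ :=
  {b : ℝ | 0 < b ∧ ∫⁻ x, ENNReal.ofReal (Φ (|f x| / b)) ∂μ ≤ 1}

/-- The Orlicz (Luxemburg) norm `‖f‖_{L_Φ} = inf {b > 0 : ∫ Φ(|f|/b) dμ ≤ 1}`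
(equal to `∞` when no such `b` exists). -/
noncomputable def orliczNorm {α : Type*} [MeasurableSpace α] (μ : Measure α) (Φ : ℝ → ℝ)
    (f : α → ℝ) : ℝ≥0∞ :=
  ⨅ b ∈ orliczSet μ Φ f, ENNReal.ofReal b

/-- `f ∈ L_Φ`: `f` is measurable and some `b > 0` satisfies `∫ Φ(|f|/b) dμ ≤ 1`. -/
def MemOrlicz {α : Type*} [MeasurableSpace α] (μ : Measure α) (Φ : ℝ → ℝ)
    (f : α → ℝ) : Prop :=
  Measurable f ∧ (orliczSet μ Φ f).Nonempty

/-- The set `{b > 0 : sup_{t>0} Φ(t)·μ{|f|/b > t} ≤ 1}` defining the weak Orlicz quasi-norm. -/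
def wOrliczSet {α : Type*} [MeasurableSpace α] (μ : Measure α) (Φ : ℝ → ℝ)
    (f : α → ℝ) : Set ℝ :=
  {b : ℝ | 0 < b ∧ ∀ t > 0, ENNReal.ofReal (Φ t) * μ {x | t < |f x| / b} ≤ 1}

/-- The weak Orlicz quasi-norm `‖f‖_{wL_Φ}` (equal to `∞` when no admissible `b` exists). -/
noncomputable def wOrliczNorm {α : Type*} [MeasurableSpace α] (μ : Measure α) (Φ : ℝ → ℝ)
    (f : α → ℝ) : ℝ≥0∞ :=
  ⨅ b ∈ wOrliczSet μ Φ f, ENNReal.ofReal b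

/-- `f ∈ wL_Φ`: `f` is measurable and `‖f‖_{wL_Φ} < ∞`. -/
def MemwOrlicz {α : Type*} [MeasurableSpace α] (μ : Measure α) (Φ : ℝ → ℝ)
    (f : α → ℝ) : Prop :=
  Measurable f ∧ wOrliczNorm μ Φ f < ⊤

namespace IsYoung

variable {Φ : ℝ → ℝ}

lemma map_mul_le (h : IsYoung Φ) {l x : ℝ} (hl : 0 ≤ l) (hl1 : l ≤ 1) (hx : 0 ≤ x) :
    Φ (l * x) ≤ l * Φ x := by
  have := h.convexOn.2 (Set.mem_Ici.2 hx) (Set.mem_Ici.2 le_rfl) hl (sub_nonneg.2 hl1) (by ring)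
  simpa [h.map_zero] using this

lemma mono (h : IsYoung Φ) {a b : ℝ} (ha : 0 ≤ a) (hab : a ≤ b) : Φ a ≤ Φ b := by
  rcases (ha.trans hab).eq_or_lt with hb | hb
  · have : a = b := by linarith
    rw [this]
  · have h1 : a / b ≤ 1 := (div_le_one hb).2 hab
    have := h.map_mul_le (div_nonneg ha hb.le) h1 hb.le
    rw [div_mul_cancel₀ _ hb.ne'] at this
    nlinarith [h.nonneg b hb.le]

lemma measurable_comp_abs (h : IsYoung Φ) : Measurable fun x : ℝ => Φ |x| := by
  have hm : Monotone fun x : ℝ => Φ (max x 0) := fun a b hab =>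
    h.mono (le_max_right _ _) (max_le_max_right _ hab)
  have := hm.measurable.comp measurable_norm (α := ℝ)
  simpa [Function.comp_def] using this

lemma le_youngInv (h : IsYoung Φ) {a s : ℝ} (ha : Φ a ≤ s) : a ≤ youngInv Φ s := by
  refine le_csInf ?_ ?_
  · obtain ⟨r, hr, hr0⟩ :=
      ((h.tendsto_top.eventually_gt_atTop s).and (eventually_ge_atTop 0)).exists
    exact ⟨r, hr0, hr⟩
  · rintro r ⟨hr0, hr⟩
    by_contra! hra
    linarith [h.mono hr0 hra.le]

lemma youngInv_nonneg (Φ : ℝ → ℝ) (s : ℝ) : 0 ≤ youngInv Φ s :=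
  Real.sInf_nonneg fun _ hr => hr.1

lemma map_youngInv_le (h : IsYoung Φ) {s : ℝ} (hs : 0 ≤ s) : Φ (youngInv Φ s) ≤ s := by
  rcases (youngInv_nonneg Φ s).eq_or_lt with h0 | h0
  · rw [← h0, h.map_zero]
    exact hs
  · have hc : Tendsto Φ (nhdsWithin (youngInv Φ s) (Set.Iio (youngInv Φ s)))
        (nhds (Φ (youngInv Φ s))) :=
      (h.leftCont _ h0).mono_left (nhdsWithin_mono _ Set.Iio_subset_Iic_self)
    refine le_of_tendsto hc ?_
    filter_upwards [Ioo_mem_nhdsLT h0] with r hr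
    by_contra! hsr
    exact hr.2.not_ge (csInf_le ⟨0, fun _ hr => hr.1⟩ ⟨hr.1.le, hsr⟩)

end IsYoung

section Luxemburg

variable {α : Type*} [MeasurableSpace α] {μ : Measure α} {Φ₁ Φ₂ Φ₃ : ℝ → ℝ}

lemma mul_mem_orliczSet (h1 : IsYoung Φ₁) (h3 : IsYoung Φ₃) {C : ℝ} (hC : 0 < C)
    (hΦ : ∀ s ≥ 0, ∀ t ≥ 0, Φ₃ (s * t / C) ≤ Φ₁ s + Φ₂ t) {f g : α → ℝ} (hf : Measurable f)
    {a b : ℝ} (ha : a ∈ orliczSet μ Φ₁ f) (hb : b ∈ orliczSet μ Φ₂ g) :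
    2 * C * (a * b) ∈ orliczSet μ Φ₃ (fun x => f x * g x) := by
  obtain ⟨ha0, ha⟩ := ha
  obtain ⟨hb0, hb⟩ := hb
  refine ⟨by positivity, ?_⟩
  have hmeas : Measurable fun x => ENNReal.ofReal (Φ₁ (|f x| / a)) := by
    have := (h1.measurable_comp_abs.comp (hf.div_const a)).ennreal_ofReal
    simpa [Function.comp_def, abs_div, abs_of_pos ha0] using this
  have hpt : ∀ x, ENNReal.ofReal (Φ₃ (|f x * g x| / (2 * C * (a * b)))) ≤
      ENNReal.ofReal (1 / 2) *
        (ENNReal.ofReal (Φ₁ (|f x| / a)) + ENNReal.ofReal (Φ₂ (|g x| / b))) := by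
    intro x
    have hs : 0 ≤ |f x| / a := by positivity
    have ht : 0 ≤ |g x| / b := by positivity
    have hst : 0 ≤ |f x| / a * (|g x| / b) / C := by positivity
    have e : |f x * g x| / (2 * C * (a * b)) = 1 / 2 * (|f x| / a * (|g x| / b) / C) := by
      rw [abs_mul]
      field_simp
    refine le_trans ?_ (mul_le_mul_right ENNReal.ofReal_add_le _)
    rw [← ENNReal.ofReal_mul (by norm_num), e]
    refine ENNReal.ofReal_le_ofReal ?_
    linarith [h3.map_mul_le (l := 1 / 2) (by norm_num) (by norm_num) hst, hΦ _ hs _ ht]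
  calc _ ≤ ∫⁻ x, ENNReal.ofReal (1 / 2) *
        (ENNReal.ofReal (Φ₁ (|f x| / a)) + ENNReal.ofReal (Φ₂ (|g x| / b))) ∂μ :=
        lintegral_mono hpt
    _ = ENNReal.ofReal (1 / 2) * (∫⁻ x, ENNReal.ofReal (Φ₁ (|f x| / a)) ∂μ +
          ∫⁻ x, ENNReal.ofReal (Φ₂ (|g x| / b)) ∂μ) := by
        rw [lintegral_const_mul' _ _ ENNReal.ofReal_ne_top, lintegral_add_left hmeas]
    _ ≤ ENNReal.ofReal (1 / 2) * (1 + 1) := by gcongr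
    _ = 1 := by
        rw [← ENNReal.ofReal_one, ← ENNReal.ofReal_add (by norm_num) (by norm_num),
          ← ENNReal.ofReal_mul (by norm_num)]
        norm_num

lemma orliczNorm_ne_top_iff {Φ : ℝ → ℝ} {f : α → ℝ} :
    orliczNorm μ Φ f ≠ ⊤ ↔ (orliczSet μ Φ f).Nonempty := by
  rw [orliczNorm, ne_eq, iInf₂_eq_top]
  simp [Set.Nonempty]

lemma orliczNorm_mul_le (h1 : IsYoung Φ₁) (h3 : IsYoung Φ₃) {C : ℝ} (hC : 0 < C)
    (hΦ : ∀ s ≥ 0, ∀ t ≥ 0, Φ₃ (s * t / C) ≤ Φ₁ s + Φ₂ t) {f g : α → ℝ}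
    (hf : MemOrlicz μ Φ₁ f) (hg : MemOrlicz μ Φ₂ g) :
    orliczNorm μ Φ₃ (fun x => f x * g x) ≤
      ENNReal.ofReal (2 * C) * (orliczNorm μ Φ₁ f * orliczNorm μ Φ₂ g) := by
  have key : ∀ a ∈ orliczSet μ Φ₁ f, ∀ b ∈ orliczSet μ Φ₂ g,
      orliczNorm μ Φ₃ (fun x => f x * g x) / ENNReal.ofReal (2 * C) ≤
        ENNReal.ofReal a * ENNReal.ofReal b := by
    intro a ha b hb
    refine ENNReal.div_le_of_le_mul' ?_
    rw [← ENNReal.ofReal_mul ha.1.le, ← ENNReal.ofReal_mul (by positivity)]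
    exact iInf₂_le _ (mul_mem_orliczSet h1 h3 hC hΦ hf.1 ha hb)
  have hC0 : ENNReal.ofReal (2 * C) ≠ 0 := by simpa using hC
  rw [mul_comm (ENNReal.ofReal _), ← ENNReal.div_le_iff hC0 ENNReal.ofReal_ne_top]
  have key2 : ∀ a ∈ orliczSet μ Φ₁ f,
      orliczNorm μ Φ₃ (fun x => f x * g x) / ENNReal.ofReal (2 * C) ≤
        ENNReal.ofReal a * orliczNorm μ Φ₂ g := by
    intro a ha
    have ha0 : ENNReal.ofReal a ≠ 0 := by simpa using ha.1
    rw [mul_comm (ENNReal.ofReal a), ← ENNReal.div_le_iff ha0 ENNReal.ofReal_ne_top]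
    refine le_iInf₂ fun b hb => ?_
    rw [ENNReal.div_le_iff ha0 ENNReal.ofReal_ne_top, mul_comm (ENNReal.ofReal b)]
    exact key a ha b hb
  rcases eq_or_ne (orliczNorm μ Φ₂ g) 0 with h0 | h0
  · obtain ⟨a, ha⟩ := hf.2
    simpa [h0] using key2 a ha
  have hgt := orliczNorm_ne_top_iff.2 hg.2
  rw [← ENNReal.div_le_iff h0 hgt]
  refine le_iInf₂ fun a ha => ?_
  rw [ENNReal.div_le_iff h0 hgt]
  exact key2 a ha

end Luxemburg

section Simple

variable {α : Type*} [MeasurableSpace α] {μ : Measure α} {E : ℕ → Set α}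

lemma exists_measurable_eq_on_disjoint (hE : ∀ k, MeasurableSet (E k))
    (hd : Pairwise (Function.onFun Disjoint E)) (c : ℕ → ℝ) :
    ∃ f : α → ℝ, Measurable f ∧ (∀ k, ∀ x ∈ E k, f x = c k) ∧ ∀ x ∉ ⋃ k, E k, f x = 0 := by
  obtain ⟨f, hf, hfc⟩ := exists_measurable_piecewise E hE (fun k _ => c k)
    (fun _ => measurable_const) (fun i j hij x hx =>
      (Set.disjoint_left.1 (hd hij) hx.1 hx.2).elim)
  refine ⟨(⋃ k, E k).indicator f, hf.indicator (.iUnion hE), fun k x hx => ?_, fun x hx => ?_⟩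
  · rw [Set.indicator_of_mem (Set.mem_iUnion.2 ⟨k, hx⟩)]
    exact hfc k hx
  · exact Set.indicator_of_notMem hx f

lemma lintegral_comp_eq_tsum (hE : ∀ k, MeasurableSet (E k))
    (hd : Pairwise (Function.onFun Disjoint E)) {c : ℕ → ℝ} {f : α → ℝ}
    (hf : ∀ k, ∀ x ∈ E k, f x = c k) (hf0 : ∀ x ∉ ⋃ k, E k, f x = 0) {F : ℝ → ℝ≥0∞}
    (hF : F 0 = 0) : ∫⁻ x, F (f x) ∂μ = ∑' k, F (c k) * μ (E k) := by
  have : ∫⁻ x, F (f x) ∂μ = ∫⁻ x in ⋃ k, E k, F (f x) ∂μ := by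
    rw [← lintegral_indicator (.iUnion hE)]
    congr 1 with x
    by_cases hx : x ∈ ⋃ k, E k
    · rw [Set.indicator_of_mem hx]
    · rw [Set.indicator_of_notMem hx, hf0 x hx, hF]
  rw [this, lintegral_iUnion hE hd]
  congr 1 with k
  rw [setLIntegral_congr_fun (g := fun _ => F (c k)) (hE k) fun x hx => by simp only [hf k x hx],
    setLIntegral_const]

end Simple

lemma exists_disjoint_measure_eq {n : ℕ} (hn : 0 < n) (m : ℕ → ℝ) (hm : ∀ k, 0 ≤ m k) :
    ∃ E : ℕ → Set (EuclideanSpace ℝ (Fin n)), (∀ k, MeasurableSet (E k)) ∧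
      Pairwise (Function.onFun Disjoint E) ∧ ∀ k, volume (E k) = ENNReal.ofReal (m k) := by
  have : Nonempty (Fin n) := ⟨⟨0, hn⟩⟩
  set w : ℝ := (volume (Metric.ball (0 : EuclideanSpace ℝ (Fin n)) 1)).toReal with hw
  have hwt : volume (Metric.ball (0 : EuclideanSpace ℝ (Fin n)) 1) ≠ ⊤ := measure_ball_lt_top.ne
  have hw0 : 0 < w := ENNReal.toReal_pos (Metric.measure_ball_pos _ _ one_pos).ne' hwt
  set S : ℕ → ℝ := fun k => ∑ j ∈ Finset.range k, m j with hS
  have hS0 : ∀ k, 0 ≤ S k := fun k => Finset.sum_nonneg fun j _ => hm j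
  set R : ℕ → ℝ := fun k => (S k / w) ^ (1 / (n : ℝ)) with hR
  have hR0 : ∀ k, 0 ≤ R k := fun k => Real.rpow_nonneg (div_nonneg (hS0 k) hw0.le) _
  have hSm : Monotone S := monotone_nat_of_le_succ fun k => by
    simp only [hS, Finset.sum_range_succ]
    linarith [hm k]
  have hRm : Monotone R := fun i j hij =>
    Real.rpow_le_rpow (div_nonneg (hS0 i) hw0.le)
      (div_le_div_of_nonneg_right (hSm hij) hw0.le) (by positivity)
  have hball : ∀ k, volume (Metric.ball (0 : EuclideanSpace ℝ (Fin n)) (R k)) =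
      ENNReal.ofReal (S k) := by
    intro k
    have hRn : R k ^ n = S k / w := by
      rw [hR]
      simp only [one_div]
      exact Real.rpow_inv_natCast_pow (div_nonneg (hS0 k) hw0.le) hn.ne'
    rw [Measure.addHaar_ball _ _ (hR0 k), finrank_euclideanSpace_fin, hRn,
      ← ENNReal.ofReal_toReal hwt, ← hw, ← ENNReal.ofReal_mul (div_nonneg (hS0 k) hw0.le),
      div_mul_cancel₀ _ hw0.ne']
  have hmono : Monotone fun k => Metric.ball (0 : EuclideanSpace ℝ (Fin n)) (R k) :=
    fun i j hij => Metric.ball_subset_ball (hRm hij)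
  refine ⟨fun k => Metric.ball 0 (R (k + 1)) \ Metric.ball 0 (R k),
    fun k => measurableSet_ball.diff measurableSet_ball, ?_, fun k => ?_⟩
  · refine (symm_disjoint.pairwise_on _).2 fun i j hij => ?_
    exact Set.disjoint_left.2 fun x hx hx' => hx'.2 (hmono (Nat.succ_le_of_lt hij) hx.1)
  · rw [measure_sdiff (hmono k.le_succ) measurableSet_ball.nullMeasurableSet
      measure_ball_lt_top.ne, hball, hball, ← ENNReal.ofReal_sub _ (hS0 k)]
    congr 1
    simp [hS, Finset.sum_range_succ]

lemma exists_le_add_of_forall_memOrlicz_mul {n : ℕ} (hn : 0 < n) {Φ₁ Φ₂ Φ₃ : ℝ → ℝ}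
    (h1 : IsYoung Φ₁) (h2 : IsYoung Φ₂) (h3 : IsYoung Φ₃)
    (H : ∀ f g : EuclideanSpace ℝ (Fin n) → ℝ, MemOrlicz volume Φ₁ f → MemOrlicz volume Φ₂ g →
      MemOrlicz volume Φ₃ (fun x => f x * g x)) :
    ∃ C > 0, ∀ s ≥ 0, ∀ t ≥ 0, Φ₃ (s * t / C) ≤ Φ₁ s + Φ₂ t := by
  by_contra! hcon
  choose s hs t ht hst using fun k : ℕ => hcon (4 ^ k) (by positivity)
  set v : ℕ → ℝ := fun k => Φ₃ (s k * t k / 4 ^ k) with hv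
  have hs1 : ∀ k, Φ₁ (s k) ≤ v k := fun k => by linarith [hst k, h2.nonneg _ (ht k)]
  have ht1 : ∀ k, Φ₂ (t k) ≤ v k := fun k => by linarith [hst k, h1.nonneg _ (hs k)]
  have hv0 : ∀ k, 0 < v k := fun k => by
    linarith [hst k, h1.nonneg _ (hs k), h2.nonneg _ (ht k)]
  have hm : ∀ k, 0 ≤ 1 / 2 / 2 ^ k / v k := fun k => by
    have := hv0 k
    positivity
  obtain ⟨E, hE, hd, hvol⟩ := exists_disjoint_measure_eq hn (fun k => 1 / 2 / 2 ^ k / v k) hm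
  have mem : ∀ {Φ : ℝ → ℝ} {c : ℕ → ℝ} {f : EuclideanSpace ℝ (Fin n) → ℝ}, IsYoung Φ →
      (∀ k, 0 ≤ c k) → (∀ k, Φ (c k) ≤ v k) → Measurable f → (∀ k, ∀ x ∈ E k, f x = c k) →
      (∀ x ∉ ⋃ k, E k, f x = 0) → MemOrlicz volume Φ f := by
    intro Φ c f hΦ hc hcv hf hfc hf0
    refine ⟨hf, 1, one_pos, ?_⟩
    rw [lintegral_comp_eq_tsum hE hd hfc hf0 (F := fun y => ENNReal.ofReal (Φ (|y| / 1)))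
      (by simp [hΦ.map_zero])]
    calc _ ≤ ∑' k : ℕ, ENNReal.ofReal (1 / 2 / 2 ^ k) := by
          refine ENNReal.tsum_le_tsum fun k => ?_
          rw [hvol, div_one, abs_of_nonneg (hc k), ← ENNReal.ofReal_mul (hΦ.nonneg _ (hc k))]
          refine ENNReal.ofReal_le_ofReal ?_
          calc Φ (c k) * (1 / 2 / 2 ^ k / v k) ≤ v k * (1 / 2 / 2 ^ k / v k) :=
                mul_le_mul_of_nonneg_right (hcv k) (hm k)
            _ = 1 / 2 / 2 ^ k := mul_div_cancel₀ _ (hv0 k).ne'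
      _ = 1 := by
          rw [← ENNReal.ofReal_tsum_of_nonneg (fun k => by positivity) (summable_geometric_two' 1),
            tsum_geometric_two', ENNReal.ofReal_one]
  obtain ⟨f, hf, hfc, hf0⟩ := exists_measurable_eq_on_disjoint hE hd s
  obtain ⟨g, hg, hgc, hg0⟩ := exists_measurable_eq_on_disjoint hE hd t
  obtain ⟨-, b, hb, hle⟩ := H f g (mem h1 hs hs1 hf hfc hf0) (mem h2 ht ht1 hg hgc hg0)
  rw [lintegral_comp_eq_tsum hE hd (f := fun x => f x * g x) (c := fun k => s k * t k)
    (fun k x hx => by rw [hfc k x hx, hgc k x hx]) (fun x hx => by rw [hf0 x hx, zero_mul])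
    (F := fun y => ENNReal.ofReal (Φ₃ (|y| / b))) (by simp [h3.map_zero])] at hle
  obtain ⟨k, hk⟩ := pow_unbounded_of_one_lt (2 * b) (one_lt_two (α := ℝ))
  have hterm := (ENNReal.le_tsum k).trans hle
  have hstk : 0 ≤ s k * t k := mul_nonneg (hs k) (ht k)
  have h4 : (4 : ℝ) ^ k = 2 ^ k * 2 ^ k := by rw [← mul_pow]; norm_num
  have h2k : (1 : ℝ) ≤ 2 ^ k := one_le_pow₀ one_le_two
  have hb4 : b ≤ 4 ^ k := by nlinarith
  rw [hvol, abs_of_nonneg hstk, ← ENNReal.ofReal_mul (h3.nonneg _ (by positivity)),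
    ENNReal.ofReal_le_one] at hterm
  have hscale : v k ≤ b / 4 ^ k * Φ₃ (s k * t k / b) := by
    have := h3.map_mul_le (l := b / 4 ^ k) (x := s k * t k / b) (by positivity)
      ((div_le_one (by positivity)).2 hb4) (by positivity)
    rwa [show b / 4 ^ k * (s k * t k / b) = s k * t k / 4 ^ k by field_simp] at this
  have hvk := hv0 k
  rw [mul_div_assoc', div_le_one hvk] at hterm
  rw [div_mul_eq_mul_div, le_div_iff₀ (by positivity), h4] at hscale
  set P : ℝ := 2 ^ k
  set y := Φ₃ (s k * t k / b)
  have hP : 0 < P := by positivity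
  have hy : y ≤ v k * (2 * P) := by
    rw [show y * (1 / 2 / P) = y / (2 * P) by field_simp, div_le_iff₀ (by positivity)] at hterm
    exact hterm
  have : v k * (P * P) ≤ b * (v k * (2 * P)) := hscale.trans (mul_le_mul_of_nonneg_left hy hb.le)
  have hlt : v k * P * (2 * b) < v k * P * P := mul_lt_mul_of_pos_left hk (by positivity)
  linarith

/-- O'Neil's characterization of Hölder's inequality in Orlicz spaces. -/
theorem holder_orlicz_tfae {n : ℕ} (hn : 0 < n) (Φ₁ Φ₂ Φ₃ : ℝ → ℝ)
    (h1 : IsYoung Φ₁) (h2 : IsYoung Φ₂) (h3 : IsYoung Φ₃) :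
    List.TFAE
      [ ∃ C > 0, ∀ t ≥ 0, youngInv Φ₁ t * youngInv Φ₂ t ≤ C * youngInv Φ₃ t,
        ∃ C > 0, ∀ s ≥ 0, ∀ t ≥ 0, Φ₃ (s * t / C) ≤ Φ₁ s + Φ₂ t,
        ∃ M > 0, ∀ f g : EuclideanSpace ℝ (Fin n) → ℝ,
          MemOrlicz (volume : Measure (EuclideanSpace ℝ (Fin n))) Φ₁ f →
          MemOrlicz (volume : Measure (EuclideanSpace ℝ (Fin n))) Φ₂ g →
          orliczNorm volume Φ₃ (fun x => f x * g x) ≤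
            ENNReal.ofReal M * (orliczNorm volume Φ₁ f * orliczNorm volume Φ₂ g),
        ∀ f g : EuclideanSpace ℝ (Fin n) → ℝ,
          MemOrlicz (volume : Measure (EuclideanSpace ℝ (Fin n))) Φ₁ f →
          MemOrlicz (volume : Measure (EuclideanSpace ℝ (Fin n))) Φ₂ g →
          MemOrlicz (volume : Measure (EuclideanSpace ℝ (Fin n))) Φ₃ (fun x => f x * g x) ] := by
  tfae_have 1 → 2 := by
    rintro ⟨C, hC, h⟩
    refine ⟨C, hC, fun s hs t ht => ?_⟩
    have hs1 := h1.nonneg s hs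
    have ht2 := h2.nonneg t ht
    have hu : 0 ≤ Φ₁ s + Φ₂ t := add_nonneg hs1 ht2
    have hle : s * t ≤ C * youngInv Φ₃ (Φ₁ s + Φ₂ t) :=
      (mul_le_mul (h1.le_youngInv (by linarith)) (h2.le_youngInv (by linarith)) ht
        (IsYoung.youngInv_nonneg _ _)).trans (h _ hu)
    exact (h3.mono (by positivity) ((div_le_iff₀' hC).2 hle)).trans (h3.map_youngInv_le hu)
  tfae_have 2 → 1 := by
    rintro ⟨C, hC, h⟩
    refine ⟨2 * C, by positivity, fun t ht => ?_⟩
    have i1 := IsYoung.youngInv_nonneg Φ₁ t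
    have i2 := IsYoung.youngInv_nonneg Φ₂ t
    rw [← div_le_iff₀' (by positivity)]
    refine h3.le_youngInv ?_
    have hhalf := h3.map_mul_le (l := 1 / 2) (x := youngInv Φ₁ t * youngInv Φ₂ t / C)
      (by norm_num) (by norm_num) (by positivity)
    rw [show 1 / 2 * (youngInv Φ₁ t * youngInv Φ₂ t / C) =
      youngInv Φ₁ t * youngInv Φ₂ t / (2 * C) by field_simp] at hhalf
    linarith [h _ i1 _ i2, h1.map_youngInv_le ht, h2.map_youngInv_le ht]
  tfae_have 2 → 3 := by
    rintro ⟨C, hC, h⟩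
    exact ⟨2 * C, by positivity, fun f g hf hg => orliczNorm_mul_le h1 h3 hC h hf hg⟩
  tfae_have 3 → 4 := by
    rintro ⟨M, -, h⟩ f g hf hg
    refine ⟨hf.1.mul hg.1, orliczNorm_ne_top_iff.1 (ne_top_of_le_ne_top ?_ (h f g hf hg))⟩
    exact ENNReal.mul_ne_top ENNReal.ofReal_ne_top
      (ENNReal.mul_ne_top (orliczNorm_ne_top_iff.2 hf.2) (orliczNorm_ne_top_iff.2 hg.2))
  tfae_have 4 → 2 := exists_le_add_of_forall_memOrlicz_mul hn h1 h2 h3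
  tfae_finish
end

section
/- Let m ≥ 2 and let Φ, Φ₁, …, Φ_m be Young functions. If there exists C > 0 such that ∏_{i=1}^m Φᵢ⁻¹(t) ≤ C·Φ⁻¹(t) for all t ≥ 0, then Φ((∏_{i=1}^m tᵢ)/C) ≤ Σ_{i=1}^m Φᵢ(tᵢ) for all t₁,…,t_m ≥ 0 (with the same constant C). -/
open MeasureTheory ENNReal Filter

theorem IsYoung.monotoneOn {Φ : ℝ → ℝ} (hΦ : IsYoung Φ) : MonotoneOn Φ (Set.Ici 0) := by
  intro a ha b hb hab
  have ha : 0 ≤ a := ha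
  have hb : 0 ≤ b := hb
  rcases hb.eq_or_lt with rfl | hb0
  · rw [le_antisymm hab ha]
  have hle : a / b ≤ 1 := (div_le_one hb0).2 hab
  have hconv := hΦ.convexOn.2 (Set.mem_Ici.2 hb) (Set.mem_Ici.2 le_rfl)
    (div_nonneg ha hb) (sub_nonneg.2 hle) (by ring)
  simp only [smul_eq_mul, mul_zero, add_zero, hΦ.map_zero, div_mul_cancel₀ a hb0.ne'] at hconv
  exact hconv.trans (mul_le_of_le_one_left (hΦ.nonneg b hb) hle)

theorem IsYoung.le_youngInv_s7 {Φ : ℝ → ℝ} (hΦ : IsYoung Φ) {x s : ℝ} (hx : 0 ≤ x)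
    (hxs : Φ x ≤ s) : x ≤ youngInv Φ s := by
  obtain ⟨r, hr0, hr⟩ :=
    ((eventually_ge_atTop 0).and (hΦ.tendsto_top.eventually_gt_atTop s)).exists
  refine le_csInf ⟨r, hr0, hr⟩ fun r' hr' => ?_
  by_contra! hlt
  exact (hr'.2.trans_le (hΦ.monotoneOn hr'.1 hx hlt.le)).not_ge hxs

theorem IsYoung.apply_le_of_le_youngInv {Φ : ℝ → ℝ} (hΦ : IsYoung Φ) {x s : ℝ} (hx : 0 ≤ x)
    (hs : 0 ≤ s) (hxs : x ≤ youngInv Φ s) : Φ x ≤ s := by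
  rcases hx.eq_or_lt with rfl | hx0
  · rwa [hΦ.map_zero]
  have hlim : Tendsto Φ (nhdsWithin x (Set.Iio x)) (nhds (Φ x)) :=
    (hΦ.leftCont x hx0).mono Set.Iio_subset_Iic_self
  refine le_of_tendsto hlim ?_
  filter_upwards [Ioo_mem_nhdsLT hx0] with r hr
  by_contra! hlt
  exact (hr.2.trans_le hxs).not_ge (csInf_le ⟨0, fun _ h => h.1⟩ ⟨hr.1.le, hlt⟩)

/-- If `∏ Φᵢ⁻¹(t) ≤ C·Φ⁻¹(t)` for all `t ≥ 0`, then
`Φ((∏ tᵢ)/C) ≤ Σ Φᵢ(tᵢ)` for all `tᵢ ≥ 0` (same constant `C`). -/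
theorem youngInv_prod_le_imp_young_ineq (m : ℕ) (hm : 2 ≤ m)
    (Φ : ℝ → ℝ) (Φi : Fin m → ℝ → ℝ)
    (hΦ : IsYoung Φ) (hΦi : ∀ i, IsYoung (Φi i))
    (C : ℝ) (hC : 0 < C)
    (h : ∀ t ≥ 0, (∏ i, youngInv (Φi i) t) ≤ C * youngInv Φ t) :
    ∀ t : Fin m → ℝ, (∀ i, 0 ≤ t i) → Φ ((∏ i, t i) / C) ≤ ∑ i, Φi i (t i) := by
  intro t ht
  have hs : 0 ≤ ∑ i, Φi i (t i) := Finset.sum_nonneg fun i _ => (hΦi i).nonneg _ (ht i)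
  refine hΦ.apply_le_of_le_youngInv
    (div_nonneg (Finset.prod_nonneg fun i _ => ht i) hC.le) hs ?_
  rw [div_le_iff₀' hC]
  refine (Finset.prod_le_prod (fun i _ => ht i) fun i _ => ?_).trans (h _ hs)
  exact (hΦi i).le_youngInv_s7 (ht i) (Finset.single_le_sum
    (f := fun j => Φi j (t j)) (fun j _ => (hΦi j).nonneg _ (ht j)) (Finset.mem_univ i))
end

section
/- Let m ≥ 2 and let Φ, Φ₁, …, Φ_m be Young functions. Suppose there exists C > 0 such that Φ((∏_{i=1}^m tᵢ)/C) ≤ Σ_{i=1}^m Φᵢ(tᵢ) for all t₁,…,t_m ≥ 0. Then for all fᵢ ∈ L_{Φᵢ}(ℝⁿ), i = 1,…,m, one has ‖∏_{i=1}^m fᵢ‖_{L_Φ} ≤ m·C·∏_{i=1}^m ‖fᵢ‖_{L_{Φᵢ}}. -/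
open MeasureTheory ENNReal Filter

namespace IsYoung

/-- A Young function is monotone on `[0,∞)`. -/
lemma monotoneOn_s8 {Φ : ℝ → ℝ} (hΦ : IsYoung Φ) : MonotoneOn Φ (Set.Ici 0) := by
  intro a ha b hb hab
  rcases eq_or_lt_of_le (Set.mem_Ici.1 ha) with rfl | ha'
  · rw [hΦ.map_zero]
    exact hΦ.nonneg b hb
  · refine hΦ.convexOn.le_right_of_left_le'' (Set.mem_Ici.2 le_rfl) hb ha' hab ?_
    rw [hΦ.map_zero]
    exact hΦ.nonneg a ha

lemma map_mul_le_s8 {Φ : ℝ → ℝ} (hΦ : IsYoung Φ) {c s : ℝ} (hc : 0 ≤ c) (hc1 : c ≤ 1)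
    (hs : 0 ≤ s) : Φ (c * s) ≤ c * Φ s := by
  have := hΦ.convexOn.2 (Set.mem_Ici.2 hs) (Set.mem_Ici.2 le_rfl) hc (sub_nonneg.2 hc1)
    (by ring)
  simpa [hΦ.map_zero] using this

lemma measurable_comp {α : Type*} [MeasurableSpace α] {Φ : ℝ → ℝ} (hΦ : IsYoung Φ)
    {g : α → ℝ} (hg : Measurable g) (hg0 : ∀ x, 0 ≤ g x) : Measurable fun x => Φ (g x) := by
  have hmono : Monotone fun t : ℝ => Φ (max 0 t) := fun a b hab =>
    hΦ.monotoneOn_s8 (le_max_left 0 a) (le_max_left 0 b) (max_le_max_left 0 hab)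
  simpa only [Function.comp_def, max_eq_right (hg0 _)] using hmono.measurable.comp hg

end IsYoung

/-- Products of admissible constants are admissible for the product function, up to the
factor `m * C`. -/
lemma mul_prod_mem_orliczSet {α : Type*} [MeasurableSpace α] {μ : Measure α} {m : ℕ}
    (hm : 0 < m) {Φ : ℝ → ℝ} {Φi : Fin m → ℝ → ℝ} (hΦ : IsYoung Φ)
    (hΦi : ∀ i, IsYoung (Φi i)) {C : ℝ} (hC : 0 < C)
    (h : ∀ t : Fin m → ℝ, (∀ i, 0 ≤ t i) → Φ ((∏ i, t i) / C) ≤ ∑ i, Φi i (t i))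
    {F : Fin m → α → ℝ} (hF : ∀ i, Measurable (F i)) {b : Fin m → ℝ}
    (hb : ∀ i, b i ∈ orliczSet μ (Φi i) (F i)) :
    m * C * ∏ i, b i ∈ orliczSet μ Φ (fun x => ∏ i, F i x) := by
  have hm' : (0 : ℝ) < m := Nat.cast_pos.2 hm
  have hb0 : ∀ i, 0 < b i := fun i => (hb i).1
  have hprod : 0 < ∏ i, b i := Finset.prod_pos fun i _ => hb0 i
  have hquot : ∀ i x, 0 ≤ |F i x| / b i := fun i x => div_nonneg (abs_nonneg _) (hb0 i).le
  have hmeas : ∀ i, Measurable fun x => ENNReal.ofReal (Φi i (|F i x| / b i)) := fun i =>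
    ((hΦi i).measurable_comp ((hF i).abs.div_const _) (hquot i)).ennreal_ofReal
  have hpt : ∀ x, ENNReal.ofReal (Φ (|∏ i, F i x| / (m * C * ∏ i, b i))) ≤
      ENNReal.ofReal (m : ℝ)⁻¹ * ∑ i, ENNReal.ofReal (Φi i (|F i x| / b i)) := by
    intro x
    rw [← ENNReal.ofReal_sum_of_nonneg fun i _ => (hΦi i).nonneg _ (hquot i x),
      ← ENNReal.ofReal_mul (inv_nonneg.2 hm'.le)]
    refine ENNReal.ofReal_le_ofReal ?_
    have heq : |∏ i, F i x| / (m * C * ∏ i, b i) =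
        (m : ℝ)⁻¹ * ((∏ i, |F i x| / b i) / C) := by
      rw [Finset.abs_prod, Finset.prod_div_distrib]
      field_simp
    rw [heq]
    calc _ ≤ (m : ℝ)⁻¹ * Φ ((∏ i, |F i x| / b i) / C) :=
          hΦ.map_mul_le_s8 (inv_nonneg.2 hm'.le) (inv_le_one_of_one_le₀ (by exact_mod_cast hm))
            (div_nonneg (Finset.prod_nonneg fun i _ => hquot i x) hC.le)
      _ ≤ _ := by
          gcongr
          exact h _ fun i => hquot i x
  refine ⟨by positivity, (lintegral_mono hpt).trans ?_⟩
  rw [lintegral_const_mul _ (Finset.measurable_fun_sum _ fun i _ => hmeas i),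
    lintegral_finsetSum _ fun i _ => hmeas i]
  calc _ ≤ ENNReal.ofReal (m : ℝ)⁻¹ * ∑ _i : Fin m, 1 := by
        gcongr with i
        exact (hb i).2
    _ = 1 := by
        rw [ENNReal.ofReal_inv_of_pos hm', ENNReal.ofReal_natCast]
        simpa using ENNReal.inv_mul_cancel (Nat.cast_ne_zero.2 hm.ne') (ENNReal.natCast_ne_top m)

lemma ofReal_sInf_orliczSet_le_orliczNorm {α : Type*} [MeasurableSpace α] (μ : Measure α)
    (Φ : ℝ → ℝ) (f : α → ℝ) :
    ENNReal.ofReal (sInf (orliczSet μ Φ f)) ≤ orliczNorm μ Φ f :=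
  le_iInf₂ fun _ hb => ENNReal.ofReal_le_ofReal (csInf_le ⟨0, fun _ hc => hc.1.le⟩ hb)

/-- If `Φ((∏ tᵢ)/C) ≤ Σ Φᵢ(tᵢ)` for all `tᵢ ≥ 0`, then the generalized Hölder
inequality holds in Orlicz spaces with constant `m·C`. -/
theorem generalized_holder_orlicz_of_young_ineq {n : ℕ} (m : ℕ) (hm : 2 ≤ m)
    (Φ : ℝ → ℝ) (Φi : Fin m → ℝ → ℝ)
    (hΦ : IsYoung Φ) (hΦi : ∀ i, IsYoung (Φi i))
    (C : ℝ) (hC : 0 < C)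
    (h : ∀ t : Fin m → ℝ, (∀ i, 0 ≤ t i) → Φ ((∏ i, t i) / C) ≤ ∑ i, Φi i (t i))
    (F : Fin m → EuclideanSpace ℝ (Fin n) → ℝ)
    (hF : ∀ i, MemOrlicz (volume : Measure (EuclideanSpace ℝ (Fin n))) (Φi i) (F i)) :
    orliczNorm (volume : Measure (EuclideanSpace ℝ (Fin n))) Φ (fun x => ∏ i, F i x) ≤
      ENNReal.ofReal (m * C) * ∏ i, orliczNorm volume (Φi i) (F i) := by
  have hmC : 0 ≤ m * C := by positivity
  choose u _ hu hmem using fun i =>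
    exists_seq_tendsto_sInf (hF i).2 ⟨0, fun _ hc => hc.1.le⟩
  have hlim := ENNReal.tendsto_ofReal
    ((tendsto_finsetProd Finset.univ fun i _ => hu i).const_mul (m * C))
  calc _ ≤ ENNReal.ofReal (m * C * ∏ i, sInf (orliczSet volume (Φi i) (F i))) :=
        ge_of_tendsto' hlim fun k => iInf₂_le _ <|
          mul_prod_mem_orliczSet (by lia) hΦ hΦi hC h (fun i => (hF i).1) fun i => hmem i k
    _ = ENNReal.ofReal (m * C) *
          ∏ i, ENNReal.ofReal (sInf (orliczSet volume (Φi i) (F i))) := by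
        rw [ENNReal.ofReal_mul hmC, ENNReal.ofReal_prod_of_nonneg fun i _ =>
          Real.sInf_nonneg fun _ hc => hc.1.le]
    _ ≤ _ := by
        gcongr with i
        exact ofReal_sInf_orliczSet_le_orliczNorm _ _ _
end

section
/- Let m ≥ 2 and let Φ, Φ₁, …, Φ_m be Young functions. Suppose there exists M > 0 such that ‖∏_{i=1}^m fᵢ‖_{L_Φ} ≤ M·∏_{i=1}^m ‖fᵢ‖_{L_{Φᵢ}} for all fᵢ ∈ L_{Φᵢ}(ℝⁿ), i = 1,…,m. Then ∏_{i=1}^m Φᵢ⁻¹(t) ≤ M·Φ⁻¹(t) for all t ≥ 0. -/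
open MeasureTheory ENNReal Filter

theorem youngInv_nonneg (Φ : ℝ → ℝ) (t : ℝ) : 0 ≤ youngInv Φ t :=
  Real.sInf_nonneg fun _ hr => hr.1

theorem IsYoung.nonempty_superlevel {Φ : ℝ → ℝ} (hΦ : IsYoung Φ) (t : ℝ) :
    {r : ℝ | 0 ≤ r ∧ t < Φ r}.Nonempty :=
  ((eventually_ge_atTop 0).and (hΦ.tendsto_top.eventually_gt_atTop t)).exists

theorem IsYoung.map_youngInv_le_s9 {Φ : ℝ → ℝ} (hΦ : IsYoung Φ) {t : ℝ} (ht : 0 ≤ t) :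
    Φ (youngInv Φ t) ≤ t := by
  rcases (youngInv_nonneg Φ t).eq_or_lt with h0 | h0
  · rw [← h0, hΦ.map_zero]
    exact ht
  have hlim : Tendsto Φ (nhdsWithin (youngInv Φ t) (Set.Iio (youngInv Φ t)))
      (nhds (Φ (youngInv Φ t))) :=
    (hΦ.leftCont _ h0).mono_left (nhdsWithin_mono _ Set.Iio_subset_Iic_self)
  refine le_of_tendsto hlim ?_
  filter_upwards [Ioo_mem_nhdsLT h0] with r hr
  by_contra! hlt
  exact hr.2.not_ge (csInf_le ⟨0, fun _ hx => hx.1⟩ ⟨hr.1.le, hlt⟩)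

theorem exists_measurableSet_volume_eq {n : ℕ} (hn : 0 < n) {c : ℝ} (hc : 0 ≤ c) :
    ∃ E : Set (EuclideanSpace ℝ (Fin n)), MeasurableSet E ∧ volume E = ENNReal.ofReal c := by
  have hbox : MeasurableSet
      (Set.univ.pi fun _ : Fin n => Set.Ioc (0 : ℝ) (c ^ (1 / (n : ℝ)))) :=
    MeasurableSet.univ_pi fun _ => measurableSet_Ioc
  have hmp := EuclideanSpace.volume_preserving_symm_measurableEquiv_toLp (Fin n)
  refine ⟨_, hmp.measurable hbox, ?_⟩
  rw [hmp.measure_preimage hbox.nullMeasurableSet, volume_pi_pi]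
  simp only [Real.volume_Ioc, sub_zero, Finset.prod_const, Finset.card_univ, Fintype.card_fin]
  rw [← ENNReal.ofReal_pow (Real.rpow_nonneg hc _), one_div,
    Real.rpow_inv_natCast_pow hc hn.ne']

theorem lintegral_indicator_const_div {α : Type*} [MeasurableSpace α] (μ : Measure α)
    {Φ : ℝ → ℝ} (hΦ : Φ 0 = 0) {E : Set α} (hE : MeasurableSet E) {a : ℝ} (ha : 0 ≤ a) (b : ℝ) :
    ∫⁻ x, ENNReal.ofReal (Φ (|E.indicator (fun _ => a) x| / b)) ∂μ =
      ENNReal.ofReal (Φ (a / b)) * μ E := by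
  rw [← lintegral_indicator_const hE]
  congr 1 with x
  by_cases hx : x ∈ E <;> simp [hx, hΦ, abs_of_nonneg ha]

theorem ofReal_mul_ofReal_inv_le_one_iff {x s : ℝ} (hs : 0 < s) :
    ENNReal.ofReal x * ENNReal.ofReal s⁻¹ ≤ 1 ↔ x ≤ s := by
  rw [← ENNReal.ofReal_mul' (inv_nonneg.2 hs.le), ENNReal.ofReal_le_one, mul_inv_le_iff₀ hs,
    one_mul]

/-- If the generalized Hölder inequality holds in Orlicz spaces with constant `M`,
then `∏ Φᵢ⁻¹(t) ≤ M·Φ⁻¹(t)` for all `t ≥ 0`. -/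
theorem youngInv_prod_le_of_generalized_holder_orlicz {n : ℕ} (hn : 0 < n)
    (m : ℕ) (hm : 2 ≤ m) (Φ : ℝ → ℝ) (Φi : Fin m → ℝ → ℝ)
    (hΦ : IsYoung Φ) (hΦi : ∀ i, IsYoung (Φi i))
    (M : ℝ) (hM : 0 < M)
    (h : ∀ F : Fin m → EuclideanSpace ℝ (Fin n) → ℝ,
      (∀ i, MemOrlicz (volume : Measure (EuclideanSpace ℝ (Fin n))) (Φi i) (F i)) →
      orliczNorm volume Φ (fun x => ∏ i, F i x) ≤
        ENNReal.ofReal M * ∏ i, orliczNorm volume (Φi i) (F i)) :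
    ∀ t ≥ 0, (∏ i, youngInv (Φi i) t) ≤ M * youngInv Φ t := by
  intro t ht
  set P := ∏ i, youngInv (Φi i) t with hP
  have hP0 : 0 ≤ P := Finset.prod_nonneg fun i _ => youngInv_nonneg _ _
  rw [← div_le_iff₀' hM]
  refine le_csInf (hΦ.nonempty_superlevel t) fun r ⟨hr0, hr⟩ => ?_
  rw [div_le_iff₀' hM]
  obtain ⟨s, hts, hsr⟩ := exists_between hr
  have hs : 0 < s := ht.trans_lt hts
  obtain ⟨E, hE, hvol⟩ := exists_measurableSet_volume_eq hn (inv_nonneg.2 hs.le)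
  set F : Fin m → EuclideanSpace ℝ (Fin n) → ℝ :=
    fun i => E.indicator fun _ => youngInv (Φi i) t with hF
  have hone (i : Fin m) : (1 : ℝ) ∈ orliczSet volume (Φi i) (F i) := by
    refine ⟨one_pos, ?_⟩
    rw [lintegral_indicator_const_div _ (hΦi i).map_zero hE (youngInv_nonneg _ _), hvol, div_one,
      ofReal_mul_ofReal_inv_le_one_iff hs]
    exact ((hΦi i).map_youngInv_le_s9 ht).trans hts.le
  have hnorm (i : Fin m) : orliczNorm volume (Φi i) (F i) ≤ 1 :=
    (iInf₂_le 1 (hone i)).trans ENNReal.ofReal_one.le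
  have hprod : (fun x => ∏ i, F i x) = E.indicator fun _ => P := by
    ext x
    by_cases hx : x ∈ E
    · simp [hF, hx, hP]
    · simp only [hF, Set.indicator_of_notMem hx]
      exact Finset.prod_eq_zero (Finset.mem_univ ⟨0, by omega⟩) rfl
  have hle : orliczNorm volume Φ (E.indicator fun _ => P) ≤ ENNReal.ofReal M := by
    rw [← hprod]
    exact (h F fun i => ⟨measurable_const.indicator hE, 1, hone i⟩).trans
      (mul_le_of_le_one_right' (Finset.prod_le_one' fun i _ => hnorm i))
  have hlt (c : ℝ) (hc : M < c) : P ≤ c * r := by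
    have hc0 : 0 < c := hM.trans hc
    have hlt := hle.trans_lt ((ENNReal.ofReal_lt_ofReal_iff hc0).2 hc)
    simp only [orliczNorm, iInf_lt_iff] at hlt
    obtain ⟨b, ⟨hb0, hb⟩, hbc⟩ := hlt
    rw [lintegral_indicator_const_div _ hΦ.map_zero hE hP0, hvol,
      ofReal_mul_ofReal_inv_le_one_iff hs] at hb
    have hPr : P / b ≤ r := by
      by_contra! hrP
      exact (hb.trans_lt hsr).not_ge
        (hΦ.monotoneOn (Set.mem_Ici.2 hr0) (Set.mem_Ici.2 (hr0.trans hrP.le)) hrP.le)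
    exact ((div_le_iff₀' hb0).1 hPr).trans
      (mul_le_mul_of_nonneg_right ((ENNReal.ofReal_lt_ofReal_iff hc0).1 hbc).le hr0)
  exact ge_of_tendsto (((continuous_id.mul continuous_const).tendsto M).mono_left
    nhdsWithin_le_nhds : Tendsto (fun c => c * r) (nhdsWithin M (Set.Ioi M)) _)
    (eventually_mem_nhdsWithin.mono hlt)
end
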